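/- Let K ∈ ℝ^{k×k×g×h} be a multi-channel convolutional kernel and let M = M(K) be the hN²×gN² structured transformation matrix corresponding to K. Assume σ_min(M) is positive and simple, with normalized left and right singular vectors u, v (Mv = σ_min(M)·u, Mᵀu = σ_min(M)·v, ‖u‖₂ = ‖v‖₂ = 1). Fix kernel indices (p,q,z,y) and let Ω_{p,q,z,y} be the set of all matrix index pairs ((c,r,s),(d,i,j)) at which the entry of M(K) equals K_{p,q,z,y}. Then the function t ↦ ½‖M(K + t·E_{pqzy})‖_F² − min(g,h)·N²·σ_min(M(K + t·E_{pqzy})) has derivative at t = 0 equal to Σ_{((c,r,s),(d,i,j)) ∈ Ω_{p,q,z,y}} ( M(K)_{(c,r,s),(d,i,j)} − min(g,h)·N²·u(c,r,s)·v(d,i,j) ). -/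

import Mathlib

open Matrix
open scoped BigOperators

noncomputable section

/-- Square of the Frobenius norm of a real matrix: `‖A‖_F² = ∑ i j, (A i j)²`. -/
def frobSq {m n : Type*} [Fintype m] [Fintype n] (A : Matrix m n ℝ) : ℝ :=
  ∑ i, ∑ j, A i j ^ 2

/-- The Euclidean (ℓ²) norm of a real vector. -/
def l2norm {n : Type*} [Fintype n] (x : n → ℝ) : ℝ :=
  Real.sqrt (∑ i, x i ^ 2)

/-- A singular value `σ` of `A` is simple if the eigenvalue `σ²` of `AᵀA` has
multiplicity one, i.e. the corresponding eigenspace is one-dimensional. -/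
def IsSimpleSingularValue {m n : Type*} [Fintype m] [Fintype n] [DecidableEq n]
    (A : Matrix m n ℝ) (σ : ℝ) : Prop :=
  Module.finrank ℝ (Module.End.eigenspace (Matrix.mulVecLin (Aᵀ * A)) (σ ^ 2)) = 1

/-- The smallest singular value of `A` : `σ_min(A) = min_{‖x‖₂ = 1} ‖A x‖₂`. -/
def sigmaMin {m n : Type*} [Fintype m] [Fintype n] (A : Matrix m n ℝ) : ℝ :=
  sInf {c : ℝ | ∃ x : n → ℝ, l2norm x = 1 ∧ c = l2norm (A.mulVec x)}

/-- The entry `K_{p,q,d,c}` of a `k × k × g × h` kernel at 0-based integer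
spatial positions `(p, q)`, extended by zero outside `{0, …, k-1}²`. -/
def kerEntry4 (k g h : ℕ) (K : Fin k → Fin k → Fin g → Fin h → ℝ)
    (p q : ℤ) (d : Fin g) (c : Fin h) : ℝ :=
  if hp : 0 ≤ p ∧ p < k then
    if hq : 0 ≤ q ∧ q < k then K ⟨p.toNat, by omega⟩ ⟨q.toNat, by omega⟩ d c else 0
  else 0

/-- The `hN² × gN²` structured transformation matrix `M(K)` corresponding to a
multi-channel kernel `K ∈ ℝ^{k×k×g×h}`: rows are indexed by triples `(c,r,s)`,
columns by triples `(d,i,j)`; in 1-based notation the entry at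
`((c,r,s),(d,i,j))` equals `K (i-r+m) (j-s+m) d c` if `1 ≤ i-r+m ≤ k` and
`1 ≤ j-s+m ≤ k` (where `m = ⌈k/2⌉`), and `0` otherwise.  Its `(c,d)` block is
the doubly block banded Toeplitz matrix of the one-channel kernel `K_{:,:,d,c}`.
Indices here are 0-based `Fin`s. -/
def convMatrix4 (k g h N : ℕ) (K : Fin k → Fin k → Fin g → Fin h → ℝ) :
    Matrix (Fin h × Fin N × Fin N) (Fin g × Fin N × Fin N) ℝ :=
  fun crs dij =>
    kerEntry4 k g h K
      (((dij.2.1 : ℕ) : ℤ) - ((crs.2.1 : ℕ) : ℤ) + ((k : ℤ) + 1) / 2 - 1)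
      (((dij.2.2 : ℕ) : ℤ) - ((crs.2.2 : ℕ) : ℤ) + ((k : ℤ) + 1) / 2 - 1)
      dij.1 crs.1

/-- The `k × k × g × h` tensor `E_{pqzy}` with `1` in position `(p,q,z,y)` and
`0` elsewhere. -/
def stdKer4 (k g h : ℕ) (p q : Fin k) (z : Fin g) (y : Fin h) :
    Fin k → Fin k → Fin g → Fin h → ℝ :=
  fun p' q' z' y' => if p' = p ∧ q' = q ∧ z' = z ∧ y' = y then 1 else 0

open scoped RealInnerProductSpace

section SpectralGap

variable {E F : Type*} [NormedAddCommGroup E] [InnerProductSpace ℝ E]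
  [NormedAddCommGroup F] [InnerProductSpace ℝ F]

/-- A vector at which `‖A x‖² - c ‖x‖² ≥ 0` vanishes is a critical point of this form. -/
lemma inner_map_map_eq_of_norm_sq_eq {A : E →L[ℝ] F} {c : ℝ}
    (hA : ∀ x, c * ‖x‖ ^ 2 ≤ ‖A x‖ ^ 2) {w : E} (hw : ‖A w‖ ^ 2 = c * ‖w‖ ^ 2) (y : E) :
    ⟪A w, A y⟫ = c * ⟪w, y⟫ := by
  have key : ∀ e : ℝ, 0 ≤ (‖A y‖ ^ 2 - c * ‖y‖ ^ 2) * (e * e) +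
      2 * (⟪A w, A y⟫ - c * ⟪w, y⟫) * e + 0 := by
    intro e
    have h := hA (w + e • y)
    rw [map_add, map_smul, norm_add_sq_real, norm_add_sq_real, inner_smul_right,
      inner_smul_right, norm_smul, norm_smul, mul_pow, mul_pow, Real.norm_eq_abs, sq_abs] at h
    nlinarith
  have h := discrim_le_zero key
  rw [discrim] at h
  nlinarith [sq_nonneg (⟪A w, A y⟫ - c * ⟪w, y⟫)]

/-- If the minimum `c` of `‖A x‖²` over unit vectors is attained only on the line spanned by `v`,
then there is a gap between `c` and the values on the orthogonal complement of `v`. -/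
lemma exists_gap_on_orthogonal [FiniteDimensional ℝ E] {A : E →L[ℝ] F} {c : ℝ}
    (hA : ∀ x, c * ‖x‖ ^ 2 ≤ ‖A x‖ ^ 2) {v : E} (hv : ‖v‖ = 1)
    (huniq : ∀ x, (∀ y, ⟪A x, A y⟫ = c * ⟪x, y⟫) → ∃ a : ℝ, x = a • v) :
    ∃ δ > 0, ∀ w, ⟪v, w⟫ = 0 → (c + δ) * ‖w‖ ^ 2 ≤ ‖A w‖ ^ 2 := by
  let S : Set E := Metric.sphere 0 1 ∩ {w | ⟪v, w⟫ = 0}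
  have hS : IsCompact S :=
    (isCompact_sphere 0 1).inter_right (isClosed_eq (by fun_prop) continuous_const)
  have hnormalize : ∀ w, ⟪v, w⟫ = 0 → w ≠ 0 → ‖w‖⁻¹ • w ∈ S := fun w hvw hw ↦
    ⟨by simp [norm_smul, hw], by simp [inner_smul_right, hvw]⟩
  obtain hempty | hne := S.eq_empty_or_nonempty
  · refine ⟨1, one_pos, fun w hvw ↦ ?_⟩
    obtain rfl | hw := eq_or_ne w 0
    · simp
    · have := hnormalize w hvw hw
      simp [hempty] at this
  · obtain ⟨w₀, hw₀, hmin⟩ := hS.exists_isMinOn hne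
      (f := fun w ↦ ‖A w‖ ^ 2) (by fun_prop)
    have hnorm : ‖w₀‖ = 1 := by simpa using hw₀.1
    have horth : ⟪v, w₀⟫ = 0 := hw₀.2
    have hlt : c < ‖A w₀‖ ^ 2 := by
      refine lt_of_le_of_ne (by simpa [hnorm] using hA w₀) fun heq ↦ ?_
      obtain ⟨a, rfl⟩ := huniq w₀
        (inner_map_map_eq_of_norm_sq_eq hA (by rw [hnorm, ← heq]; ring))
      rw [inner_smul_right, real_inner_self_eq_norm_sq, hv] at horth
      simp_all
    refine ⟨‖A w₀‖ ^ 2 - c, sub_pos.2 hlt, fun w hvw ↦ ?_⟩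
    obtain rfl | hw := eq_or_ne w 0
    · simp
    · have h : ‖A w₀‖ ^ 2 ≤ ‖A (‖w‖⁻¹ • w)‖ ^ 2 := hmin (hnormalize w hvw hw)
      have hw' : 0 < ‖w‖ := norm_pos_iff.2 hw
      rw [map_smul, norm_smul, norm_inv, norm_norm, mul_pow, inv_pow, inv_mul_eq_div,
        le_div_iff₀ (by positivity)] at h
      linarith

/-- Second-order lower bound for the minimum of a perturbed quadratic form with a simple
minimizer. -/
lemma exists_norm_sq_add_smul_lower_bound [FiniteDimensional ℝ E] (A B : E →L[ℝ] F) {c : ℝ}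
    (hA : ∀ x, c * ‖x‖ ^ 2 ≤ ‖A x‖ ^ 2) {v : E} (hv : ‖v‖ = 1)
    (hAv : ∀ y, ⟪A v, A y⟫ = c * ⟪v, y⟫)
    (huniq : ∀ x, (∀ y, ⟪A x, A y⟫ = c * ⟪x, y⟫) → ∃ a : ℝ, x = a • v) :
    ∃ C : ℝ, ∀ (t : ℝ) (x : E), ‖x‖ = 1 →
      c + 2 * t * ⟪A v, B v⟫ - C * t ^ 2 ≤ ‖A x + t • B x‖ ^ 2 := by
  obtain ⟨δ, hδ, hgap⟩ := exists_gap_on_orthogonal hA hv huniq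
  set M := ‖A‖ * ‖B‖
  have hbound : ∀ x y, |⟪A x, B y⟫| ≤ M * (‖x‖ * ‖y‖) := fun x y ↦
    calc |⟪A x, B y⟫| ≤ ‖A x‖ * ‖B y‖ := abs_real_inner_le_norm _ _
      _ ≤ (‖A‖ * ‖x‖) * (‖B‖ * ‖y‖) := by gcongr <;> exact ContinuousLinearMap.le_opNorm _ _
      _ = M * (‖x‖ * ‖y‖) := by ring
  refine ⟨16 * M ^ 2 / δ, fun t x hx ↦ ?_⟩
  set a := ⟪v, x⟫ with ha
  obtain ⟨w, hw⟩ : ∃ w, x = a • v + w := ⟨x - a • v, by simp⟩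
  have hvw : ⟪v, w⟫ = 0 := by
    have h : ⟪v, x⟫ = ⟪v, a • v + w⟫ := by rw [← hw]
    rw [inner_add_right, inner_smul_right, real_inner_self_eq_norm_sq, hv, ← ha] at h
    linarith
  have hpyth : a ^ 2 + ‖w‖ ^ 2 = 1 := by
    have h : ‖x‖ ^ 2 = ‖a • v + w‖ ^ 2 := by rw [← hw]
    rw [norm_add_sq_real, inner_smul_left, hvw, norm_smul, hv, hx, mul_pow, Real.norm_eq_abs,
      sq_abs] at h
    simpa using h.symm
  have hAx : c + δ * ‖w‖ ^ 2 ≤ ‖A x‖ ^ 2 := by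
    rw [hw, map_add, map_smul, norm_add_sq_real, inner_smul_left, hAv, hvw, norm_smul, mul_pow,
      Real.norm_eq_abs, sq_abs]
    have h₁ := hgap w hvw
    have h₂ : ‖A v‖ ^ 2 = c := by
      rw [← real_inner_self_eq_norm_sq, hAv, real_inner_self_eq_norm_sq, hv]; ring
    rw [h₂]
    simp only [mul_zero, add_zero]
    nlinarith
  have hM0 : 0 ≤ M := by positivity
  have ha1 : |a| ≤ 1 := abs_le_one_iff_mul_self_le_one.2 (by nlinarith [sq_nonneg ‖w‖])
  have hw1 : ‖w‖ ≤ 1 := by nlinarith [sq_nonneg a, norm_nonneg w]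
  have hcross : |⟪A x, B x⟫ - ⟪A v, B v⟫| ≤ 4 * M * ‖w‖ := by
    have hexp : ⟪A x, B x⟫ - ⟪A v, B v⟫ = -(‖w‖ ^ 2 * ⟪A v, B v⟫) +
        a * (⟪A v, B w⟫ + ⟪A w, B v⟫) + ⟪A w, B w⟫ := by
      rw [hw]
      simp only [map_add, map_smul, inner_add_left, inner_add_right, real_inner_smul_left,
        real_inner_smul_right]
      linear_combination ⟪A v, B v⟫ * hpyth
    have h₁ := hbound v v
    have h₂ := hbound v w
    have h₃ := hbound w v
    have h₄ := hbound w w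
    rw [hv] at h₁ h₂ h₃
    have hsq : ‖w‖ * ‖w‖ ≤ ‖w‖ := by nlinarith [norm_nonneg w]
    have hMsq : M * (‖w‖ * ‖w‖) ≤ M * ‖w‖ := by gcongr
    calc |⟪A x, B x⟫ - ⟪A v, B v⟫|
        ≤ ‖w‖ ^ 2 * |⟪A v, B v⟫| + |a| * (|⟪A v, B w⟫| + |⟪A w, B v⟫|) + |⟪A w, B w⟫| := by
          rw [hexp]
          refine (abs_add_three _ _ _).trans ?_
          rw [abs_neg, abs_mul, abs_mul, abs_of_nonneg (sq_nonneg ‖w‖)]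
          gcongr
          exact abs_add_le _ _
      _ ≤ ‖w‖ ^ 2 * (M * (1 * 1)) + 1 * (M * (1 * ‖w‖) + M * (‖w‖ * 1)) + M * (‖w‖ * ‖w‖) := by
          gcongr
      _ ≤ 4 * M * ‖w‖ := by nlinarith
  have hlin : -(|t| * (4 * M * ‖w‖)) ≤ t * (⟪A x, B x⟫ - ⟪A v, B v⟫) := by
    refine neg_le_of_abs_le ?_
    rw [abs_mul]
    gcongr
  have hamgm : 8 * |t| * M * ‖w‖ ≤ δ * ‖w‖ ^ 2 + 16 * M ^ 2 / δ * t ^ 2 := by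
    have h : 0 ≤ (δ * ‖w‖ - 4 * M * |t|) ^ 2 / δ := by positivity
    have h' : (δ * ‖w‖ - 4 * M * |t|) ^ 2 / δ =
        δ * ‖w‖ ^ 2 - 8 * |t| * M * ‖w‖ + 16 * M ^ 2 / δ * t ^ 2 := by
      rw [← sq_abs t]
      field_simp
      ring
    linarith
  rw [norm_add_sq_real, inner_smul_right]
  nlinarith [sq_nonneg ‖t • B x‖]

end SpectralGap

/-- A function whose first-order Taylor remainder is quadratically bounded is differentiable. -/
lemma hasDerivAt_zero_of_quadratic_bounds {f : ℝ → ℝ} {b C D : ℝ}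
    (hlower : ∀ t, f 0 + t * b - C * t ^ 2 ≤ f t)
    (hupper : ∀ t, f t ≤ f 0 + t * b + D * t ^ 2) : HasDerivAt f b 0 := by
  rw [hasDerivAt_iff_isLittleO_nhds_zero]
  refine Asymptotics.IsBigO.trans_isLittleO (g := fun t : ℝ ↦ t ^ 2) ?_ ?_
  · refine Asymptotics.IsBigO.of_bound (|C| + |D|) (Filter.Eventually.of_forall fun t ↦ ?_)
    have h₁ := hlower t
    have h₂ := hupper t
    rw [Real.norm_eq_abs, Real.norm_eq_abs, abs_of_nonneg (sq_nonneg t), zero_add, smul_eq_mul,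
      abs_le]
    constructor <;>
      nlinarith [sq_nonneg t, le_abs_self C, le_abs_self D, abs_nonneg C, abs_nonneg D]
  · simpa using Asymptotics.isLittleO_pow_pow (𝕜 := ℝ) one_lt_two

section SigmaMin

variable {m n : Type*} [Fintype m] [Fintype n]

lemma l2norm_eq_norm_toLp (x : n → ℝ) : l2norm x = ‖WithLp.toLp 2 x‖ := by
  simp [l2norm, EuclideanSpace.norm_eq]

lemma sigmaMin_nonneg (A : Matrix m n ℝ) : 0 ≤ sigmaMin A := by
  refine Real.sInf_nonneg ?_
  rintro _ ⟨x, -, rfl⟩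
  exact Real.sqrt_nonneg _

lemma sigmaMin_le (A : Matrix m n ℝ) {x : n → ℝ} (hx : l2norm x = 1) :
    sigmaMin A ≤ l2norm (A *ᵥ x) := by
  refine csInf_le ⟨0, ?_⟩ ⟨x, hx, rfl⟩
  rintro _ ⟨x, -, rfl⟩
  exact Real.sqrt_nonneg _

lemma le_sigmaMin_sq (A : Matrix m n ℝ) {v : n → ℝ} (hv : l2norm v = 1) {c : ℝ}
    (hc : ∀ x, l2norm x = 1 → c ≤ l2norm (A *ᵥ x) ^ 2) : c ≤ sigmaMin A ^ 2 := by
  have h : √c ≤ sigmaMin A := by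
    refine le_csInf ⟨_, v, hv, rfl⟩ ?_
    rintro _ ⟨x, hx, rfl⟩
    exact Real.sqrt_le_iff.2 ⟨Real.sqrt_nonneg _, hc x hx⟩
  exact (Real.sqrt_le_iff.1 h).2

variable [DecidableEq n]

lemma sigmaMin_sq_mul_norm_sq_le (A : Matrix m n ℝ) (x : EuclideanSpace ℝ n) :
    sigmaMin A ^ 2 * ‖x‖ ^ 2 ≤ ‖A.toEuclideanLin x‖ ^ 2 := by
  obtain rfl | hx := eq_or_ne x 0
  · simp
  have hx' : 0 < ‖x‖ := norm_pos_iff.2 hx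
  have h := sigmaMin_le A (x := (‖x‖⁻¹ • x).ofLp)
    (by rw [l2norm_eq_norm_toLp]; simp [norm_smul, hx])
  rw [l2norm_eq_norm_toLp, ← Matrix.toLpLin_apply, map_smul, norm_smul, norm_inv, norm_norm,
    inv_mul_eq_div, le_div_iff₀ hx'] at h
  rw [← mul_pow]
  gcongr
  exact mul_nonneg (sigmaMin_nonneg A) hx'.le

/-- First-order perturbation of a simple positive smallest singular value. -/
theorem hasDerivAt_sigmaMin_add_smul (A B : Matrix m n ℝ) {u : m → ℝ} {v : n → ℝ}
    (hpos : 0 < sigmaMin A) (hsimple : IsSimpleSingularValue A (sigmaMin A))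
    (hv : l2norm v = 1) (hMv : A *ᵥ v = sigmaMin A • u) (hMu : Aᵀ *ᵥ u = sigmaMin A • v) :
    HasDerivAt (fun t : ℝ ↦ sigmaMin (A + t • B)) (u ⬝ᵥ B *ᵥ v) 0 := by
  set s := sigmaMin A with hs
  have hinner : ∀ x y : n → ℝ, ⟪A.toEuclideanLin (WithLp.toLp 2 x),
      A.toEuclideanLin (WithLp.toLp 2 y)⟫ = ((Aᵀ * A) *ᵥ x) ⬝ᵥ y := by
    intro x y
    rw [← Matrix.mulVec_mulVec, Matrix.mulVec_transpose, ← Matrix.dotProduct_mulVec]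
    simp [Matrix.toLpLin_apply, EuclideanSpace.inner_eq_star_dotProduct, dotProduct_comm]
  have heig : (Aᵀ * A) *ᵥ v = s ^ 2 • v := by
    rw [← Matrix.mulVec_mulVec, hMv, Matrix.mulVec_smul, hMu, smul_smul, sq]
  have hvn : ‖WithLp.toLp 2 v‖ = 1 := by rw [← l2norm_eq_norm_toLp, hv]
  have hv0 : v ≠ 0 := by
    rintro rfl
    simp at hvn
  let A' : EuclideanSpace ℝ n →L[ℝ] EuclideanSpace ℝ m := A.toEuclideanLin.toContinuousLinearMap
  let B' : EuclideanSpace ℝ n →L[ℝ] EuclideanSpace ℝ m := B.toEuclideanLin.toContinuousLinearMap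
  have hstat : ∀ y, ⟪A' (WithLp.toLp 2 v), A' y⟫ = s ^ 2 * ⟪WithLp.toLp 2 v, y⟫ := by
    intro y
    refine (hinner v y.ofLp).trans ?_
    rw [heig, smul_dotProduct]
    simp [EuclideanSpace.inner_eq_star_dotProduct, dotProduct_comm]
  have huniq : ∀ x, (∀ y, ⟪A' x, A' y⟫ = s ^ 2 * ⟪x, y⟫) →
      ∃ a : ℝ, x = a • WithLp.toLp 2 v := by
    intro x hx
    have hx' : (Aᵀ * A) *ᵥ x.ofLp = s ^ 2 • x.ofLp := by
      refine dotProduct_eq _ _ fun y ↦ ?_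
      refine (hinner x.ofLp y).symm.trans ((hx (WithLp.toLp 2 y)).trans ?_)
      simp [EuclideanSpace.inner_eq_star_dotProduct, dotProduct_comm]
    let v' : Module.End.eigenspace (Matrix.mulVecLin (Aᵀ * A)) (s ^ 2) :=
      ⟨v, Module.End.mem_eigenspace_iff.2 heig⟩
    obtain ⟨a, ha⟩ := (finrank_eq_one_iff_of_nonzero' v' (by simpa [v'] using hv0)).1 hsimple
      ⟨x.ofLp, Module.End.mem_eigenspace_iff.2 hx'⟩
    refine ⟨a, ?_⟩
    have h : a • v = x.ofLp := congrArg Subtype.val ha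
    rw [← WithLp.toLp_smul, h]
  obtain ⟨C, hC⟩ := exists_norm_sq_add_smul_lower_bound A' B' (c := s ^ 2)
    (fun x ↦ sigmaMin_sq_mul_norm_sq_le A x) hvn hstat huniq
  have hnorm : ∀ (t : ℝ) (x : n → ℝ), l2norm ((A + t • B) *ᵥ x) =
      ‖A' (WithLp.toLp 2 x) + t • B' (WithLp.toLp 2 x)‖ := by
    intro t x
    rw [l2norm_eq_norm_toLp, Matrix.add_mulVec, Matrix.smul_mulVec]
    rfl
  have hfirst : ⟪A' (WithLp.toLp 2 v), B' (WithLp.toLp 2 v)⟫ = s * (u ⬝ᵥ B *ᵥ v) := by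
    rw [← smul_eq_mul, ← smul_dotProduct, ← hMv, dotProduct_comm]
    rfl
  have hsq : HasDerivAt (fun t : ℝ ↦ sigmaMin (A + t • B) ^ 2) (2 * (s * (u ⬝ᵥ B *ᵥ v))) 0 := by
    refine hasDerivAt_zero_of_quadratic_bounds (C := C) (D := ‖B' (WithLp.toLp 2 v)‖ ^ 2)
      (fun t ↦ ?_) fun t ↦ ?_
    · refine le_sigmaMin_sq _ hv fun x hx ↦ ?_
      rw [hnorm]
      have h := hC t (WithLp.toLp 2 x) (by rw [← l2norm_eq_norm_toLp, hx])
      rw [hfirst] at h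
      rw [zero_smul, add_zero, ← hs]
      linarith
    · have h : sigmaMin (A + t • B) ^ 2 ≤ l2norm ((A + t • B) *ᵥ v) ^ 2 :=
        pow_le_pow_left₀ (sigmaMin_nonneg _) (sigmaMin_le _ hv) 2
      have hAv : ‖A' (WithLp.toLp 2 v)‖ ^ 2 = s ^ 2 := by
        rw [← real_inner_self_eq_norm_sq, hstat, real_inner_self_eq_norm_sq, hvn]
        ring
      rw [hnorm, norm_add_sq_real, inner_smul_right, hfirst, hAv, norm_smul, mul_pow,
        Real.norm_eq_abs, sq_abs] at h
      rw [zero_smul, add_zero, ← hs]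
      linarith
  have hroot := hsq.sqrt (by simpa using hpos.ne')
  simp only [fun t : ℝ ↦ Real.sqrt_sq (sigmaMin_nonneg (A + t • B))] at hroot
  refine hroot.congr_deriv ?_
  rw [zero_smul, add_zero, ← hs]
  field_simp

end SigmaMin

lemma hasDerivAt_frobSq_add_smul {m n : Type*} [Fintype m] [Fintype n] (A B : Matrix m n ℝ) :
    HasDerivAt (fun t : ℝ ↦ frobSq (A + t • B)) (∑ i, ∑ j, 2 * (A i j * B i j)) 0 := by
  refine HasDerivAt.fun_sum fun i _ ↦ HasDerivAt.fun_sum fun j _ ↦ ?_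
  refine HasDerivAt.congr_deriv
    ((((hasDerivAt_id (0 : ℝ)).mul_const (B i j)).const_add (A i j)).fun_pow 2) ?_
  simp
  ring

lemma convMatrix4_add_smul (k g h N : ℕ) (K L : Fin k → Fin k → Fin g → Fin h → ℝ) (t : ℝ) :
    convMatrix4 k g h N (K + t • L) = convMatrix4 k g h N K + t • convMatrix4 k g h N L := by
  ext crs dij
  simp only [convMatrix4, kerEntry4, Matrix.add_apply, Matrix.smul_apply]
  split_ifs <;> simp

lemma kerEntry4_stdKer4 (k g h : ℕ) (p q : Fin k) (z : Fin g) (y : Fin h) (a b : ℤ)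
    (d : Fin g) (c : Fin h) :
    kerEntry4 k g h (stdKer4 k g h p q z y) a b d c =
      if a = ((p : ℕ) : ℤ) ∧ b = ((q : ℕ) : ℤ) ∧ d = z ∧ c = y then 1 else 0 := by
  have hp := p.2
  have hq := q.2
  simp only [kerEntry4, stdKer4, Fin.ext_iff]
  split_ifs <;> first | rfl | (exfalso; omega)

/-- Multi-channel Regularization 3: under the same hypotheses as
Regularization 2, the function
`t ↦ ½‖M(K + t·E_{pqzy})‖_F² - min(g,h)·N²·σ_min(M(K + t·E_{pqzy}))` has
derivative at `t = 0` equal to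
`∑_{((c,r,s),(d,i,j)) ∈ Ω_{p,q,z,y}} (M(K)_{(c,r,s),(d,i,j)} - min(g,h)·N²·u(c,r,s)·v(d,i,j))`. -/
theorem combined_convMatrix4_deriv (k g h N : ℕ)
    (K : Fin k → Fin k → Fin g → Fin h → ℝ)
    (u : Fin h × Fin N × Fin N → ℝ) (v : Fin g × Fin N × Fin N → ℝ)
    (hpos : 0 < sigmaMin (convMatrix4 k g h N K))
    (hsimple : IsSimpleSingularValue (convMatrix4 k g h N K)
      (sigmaMin (convMatrix4 k g h N K)))
    (hu : l2norm u = 1) (hv : l2norm v = 1)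
    (hMv : (convMatrix4 k g h N K).mulVec v = sigmaMin (convMatrix4 k g h N K) • u)
    (hMu : (convMatrix4 k g h N K)ᵀ.mulVec u = sigmaMin (convMatrix4 k g h N K) • v)
    (p q : Fin k) (z : Fin g) (y : Fin h) :
    HasDerivAt
      (fun t : ℝ =>
        (1 / 2) * frobSq (convMatrix4 k g h N (K + t • stdKer4 k g h p q z y)) -
          ((min g h * N ^ 2 : ℕ) : ℝ) *
            sigmaMin (convMatrix4 k g h N (K + t • stdKer4 k g h p q z y)))
      (∑ crs : Fin h × Fin N × Fin N, ∑ dij : Fin g × Fin N × Fin N,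
        if (((dij.2.1 : ℕ) : ℤ) - ((crs.2.1 : ℕ) : ℤ) + ((k : ℤ) + 1) / 2 - 1 = ((p : ℕ) : ℤ) ∧
            ((dij.2.2 : ℕ) : ℤ) - ((crs.2.2 : ℕ) : ℤ) + ((k : ℤ) + 1) / 2 - 1 = ((q : ℕ) : ℤ) ∧
            dij.1 = z ∧ crs.1 = y)
        then convMatrix4 k g h N K crs dij -
          ((min g h * N ^ 2 : ℕ) : ℝ) * (u crs * v dij) else 0) 0 := by
  simp only [convMatrix4_add_smul]
  set A := convMatrix4 k g h N K
  have hfrob := (hasDerivAt_frobSq_add_smul A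
    (convMatrix4 k g h N (stdKer4 k g h p q z y))).const_mul (1 / 2)
  have hsigma := (hasDerivAt_sigmaMin_add_smul A
    (convMatrix4 k g h N (stdKer4 k g h p q z y)) hpos hsimple hv hMv hMu).const_mul
      ((min g h * N ^ 2 : ℕ) : ℝ)
  refine (hfrob.fun_sub hsigma).congr_deriv ?_
  symm
  simp only [dotProduct, Matrix.mulVec, Finset.mul_sum, ← Finset.sum_sub_distrib]
  refine Finset.sum_congr rfl fun crs _ ↦ Finset.sum_congr rfl fun dij _ ↦ ?_
  rw [convMatrix4, kerEntry4_stdKer4]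
  split_ifs <;> ring
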